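/- arXiv:1609.07466 — 8 statements merged into one kernel-verified Lean document; each statement's English description precedes it below -/
import Mathlib

section
/- For any positive integer k and any integer f with 0 ≤ f ≤ pk, the sorting strategy is discreet for f with pile size k with respect to (p_1, …, p_r) if and only if the sorting strategy is discreet for pk − f with pile size k with respect to the reversed tuple (p_r, …, p_1). -/
open Finset

/-- `g = (f_1, …, f_r)` is a *general solution* for `f` with respect to the pile
multiplicities `p = (p_1, …, p_r)`: the entries are strictly increasing nonnegative
integers with `p_1 f_1 + ⋯ + p_r f_r = f`. -/
def IsGenSol {r : ℕ} (p : Fin r → ℕ) (f : ℕ) (g : Fin r → ℕ) : Prop :=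
  StrictMono g ∧ ∑ i, p i * g i = f

/-- A general solution `g` satisfies the *height bound* for `k`: its last entry `f_r`
is at most `k`. -/
def HeightBound {r : ℕ} (hr : 0 < r) (g : Fin r → ℕ) (k : ℕ) : Prop :=
  g ⟨r - 1, Nat.sub_lt hr Nat.one_pos⟩ ≤ k

/-- The sorting strategy is *discreet* for `f` with pile size `k`: there is a general
solution for `f` satisfying the height bound for `k` with `f_1 ≥ 1`, and one with
`f_r ≤ k - 1`. -/
def Discreet {r : ℕ} (hr : 0 < r) (p : Fin r → ℕ) (f k : ℕ) : Prop :=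
  (∃ g, IsGenSol p f g ∧ HeightBound hr g k ∧ 1 ≤ g ⟨0, hr⟩) ∧
  (∃ g, IsGenSol p f g ∧ HeightBound hr g k ∧
    g ⟨r - 1, Nat.sub_lt hr Nat.one_pos⟩ ≤ k - 1)

/-- `F_min = Σ_{i=1}^r (i-1) p_i` (with `0`-based indexing, `Σ_i i · p_i`). -/
def Fmin {r : ℕ} (p : Fin r → ℕ) : ℕ := ∑ i : Fin r, (i : ℕ) * p i

theorem StrictMono.le_of_heightBound {r : ℕ} (hr : 0 < r) {g : Fin r → ℕ} (hg : StrictMono g)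
    {k : ℕ} (hb : HeightBound hr g k) (i : Fin r) : g i ≤ k := by
  refine le_trans (hg.monotone ?_) hb
  rw [Fin.le_def]
  exact Nat.le_sub_one_of_lt i.isLt

/-- Complementing the heights in `k` and reversing the order turns a general solution for `f`
into one for `p k - f` with respect to the reversed tuple. -/
theorem IsGenSol.complement {r : ℕ} (hr : 0 < r) {p : Fin r → ℕ} {f k : ℕ} {g : Fin r → ℕ}
    (hg : IsGenSol p f g) (hb : HeightBound hr g k) :
    IsGenSol (fun i => p i.rev) ((∑ i, p i) * k - f) (fun i => k - g i.rev) := by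
  have hle := hg.1.le_of_heightBound hr hb
  refine ⟨fun i j hij => ?_, ?_⟩
  · have h₁ := hg.1 (Fin.rev_lt_rev.mpr hij)
    have h₂ := hle i.rev
    dsimp only
    omega
  · refine (Equiv.sum_comp Fin.revPerm (fun i => p i * (k - g i))).trans ?_
    have hsum : ∑ i, p i * (k - g i) + ∑ i, p i * g i = (∑ i, p i) * k := by
      rw [← Finset.sum_add_distrib, Finset.sum_mul]
      refine Finset.sum_congr rfl fun i _ => ?_
      rw [← Nat.mul_add, Nat.sub_add_cancel (hle i)]
    rw [hg.2] at hsum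
    omega

theorem Discreet.complement {r : ℕ} (hr : 0 < r) {p : Fin r → ℕ} {f k : ℕ} (hk : 0 < k)
    (h : Discreet hr p f k) :
    Discreet hr (fun i => p i.rev) ((∑ i, p i) * k - f) k := by
  have rev_zero : Fin.rev (⟨0, hr⟩ : Fin r) = ⟨r - 1, Nat.sub_lt hr Nat.one_pos⟩ := by
    ext
    simp [Fin.val_rev]
  have rev_last : Fin.rev (⟨r - 1, Nat.sub_lt hr Nat.one_pos⟩ : Fin r) = ⟨0, hr⟩ := by
    rw [← rev_zero, Fin.rev_rev]
  obtain ⟨⟨g, hg, hgb, hg₁⟩, g', hg', hgb', hg'k⟩ := h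
  refine ⟨⟨_, hg'.complement hr hgb', Nat.sub_le _ _, ?_⟩,
    _, hg.complement hr hgb, Nat.sub_le _ _, ?_⟩
  · rw [rev_zero]
    omega
  · rw [rev_last]
    omega

/-- duality of discreetness. For `0 ≤ f ≤ pk`, the sorting strategy is
discreet for `f` with pile size `k` w.r.t. `(p_1, …, p_r)` iff it is discreet for
`pk - f` with pile size `k` w.r.t. the reversed tuple `(p_r, …, p_1)`. -/
theorem discreetness_duality (r : ℕ) (hr : 2 ≤ r) (p : Fin r → ℕ) (hp : ∀ i, 0 < p i)
    (k : ℕ) (hk : 0 < k) (f : ℕ) (hf : f ≤ (∑ i, p i) * k) :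
    Discreet (by omega) p f k ↔
      Discreet (by omega) (fun i => p i.rev) ((∑ i, p i) * k - f) k := by
  refine ⟨Discreet.complement _ hk, fun h => ?_⟩
  have h' := h.complement _ hk
  have hsum : ∑ i : Fin r, p i.rev = ∑ i, p i := Equiv.sum_comp Fin.revPerm p
  simpa only [Fin.rev_rev, hsum, Nat.sub_sub_self hf] using h'
end

section
/- If k < r + 1, then the sorting strategy is not discreet for any f with pile size k. If k ≥ r + 1, then the sorting strategy is discreet for f = p + F_min with pile size k and discreet for f = p(k−1) − F'_min with pile size k, and every integer f for which the sorting strategy is discreet with pile size k satisfies p + F_min ≤ f ≤ p(k−1) − F'_min. -/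
open Finset

/-- A strictly increasing sequence of naturals grows at least as fast as its index. -/
theorem StrictMono.add_sub_le_of_fin {r : ℕ} {g : Fin r → ℕ} (hg : StrictMono g) {i j : Fin r}
    (hij : i ≤ j) : g i + ((j : ℕ) - i) ≤ g j := by
  obtain ⟨j, hj⟩ := j
  induction j with
  | zero =>
    have hi : i = ⟨0, hj⟩ := Fin.ext (Nat.le_zero.mp hij)
    simp [hi]
  | succ n ih =>
    rcases hij.eq_or_lt with rfl | hlt
    · simp
    · have hin : (i : ℕ) ≤ n := Nat.lt_succ_iff.mp hlt
      have hprev := ih (by omega) hin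
      have hstep : g ⟨n, by omega⟩ < g ⟨n + 1, hj⟩ := hg (Fin.mk_lt_mk.mpr n.lt_succ_self)
      dsimp only at hprev ⊢
      omega

theorem Fmin_rev_eq {r : ℕ} (p : Fin r → ℕ) :
    Fmin (fun i => p i.rev) = ∑ i : Fin r, p i * (r - (i + 1)) := by
  unfold Fmin
  rw [← Equiv.sum_comp Fin.revPerm]
  simp [Fin.val_rev, mul_comm]

theorem sum_mul_add_index {r : ℕ} (p : Fin r → ℕ) (a : ℕ) :
    ∑ i : Fin r, p i * (a + i) = (∑ i, p i) * a + Fmin p := by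
  simp only [Fmin, add_mul, sum_add_distrib, sum_mul, mul_comm (p _)]

theorem isGenSol_add_index {r : ℕ} (p : Fin r → ℕ) (a : ℕ) :
    IsGenSol p ((∑ i, p i) * a + Fmin p) (fun i => a + i) :=
  ⟨fun _ _ h => Nat.add_lt_add_left h a, sum_mul_add_index p a⟩

theorem discreet_add_index {r : ℕ} (hr : 0 < r) (p : Fin r → ℕ) {a k : ℕ} (ha : 1 ≤ a)
    (hak : a + r ≤ k) : Discreet hr p ((∑ i, p i) * a + Fmin p) k := by
  refine ⟨⟨_, isGenSol_add_index p a, ?_, ?_⟩, ⟨_, isGenSol_add_index p a, ?_, ?_⟩⟩ <;>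
    simp only [HeightBound] <;> omega

theorem Discreet.le {r : ℕ} {hr : 0 < r} {p : Fin r → ℕ} {f k : ℕ} (h : Discreet hr p f k) :
    (∑ i, p i) + Fmin p ≤ f := by
  obtain ⟨⟨g, ⟨hg, rfl⟩, -, h1⟩, -⟩ := h
  rw [← mul_one (∑ i, p i), ← sum_mul_add_index]
  refine sum_le_sum fun i _ => Nat.mul_le_mul_left _ ?_
  have := hg.add_sub_le_of_fin (i := ⟨0, hr⟩) (j := i) (Nat.zero_le i)
  dsimp only at this
  omega

theorem Discreet.add_Fmin_rev_le {r : ℕ} {hr : 0 < r} {p : Fin r → ℕ} {f k : ℕ}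
    (h : Discreet hr p f k) : f + Fmin (fun i => p i.rev) ≤ (∑ i, p i) * (k - 1) := by
  obtain ⟨-, g, ⟨hg, rfl⟩, -, h1⟩ := h
  rw [Fmin_rev_eq, ← sum_add_distrib, sum_mul]
  refine sum_le_sum fun i _ => ?_
  rw [← mul_add]
  refine Nat.mul_le_mul_left _ ?_
  have := hg.add_sub_le_of_fin (i := i) (j := ⟨r - 1, Nat.sub_lt hr Nat.one_pos⟩)
    (Nat.le_sub_one_of_lt i.isLt)
  dsimp only at this
  omega

theorem Fmin_add_Fmin_rev {r : ℕ} (p : Fin r → ℕ) :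
    Fmin p + Fmin (fun i => p i.rev) = (∑ i, p i) * (r - 1) := by
  rw [Fmin_rev_eq, Fmin, ← sum_add_distrib, sum_mul]
  refine sum_congr rfl fun i _ => ?_
  rw [mul_comm (i : ℕ), ← mul_add]
  congr 1
  omega

/-- If `k < r + 1` the sorting strategy is not discreet for any `f`;
if `k ≥ r + 1` it is discreet for `f = p + F_min` and for `f = p(k-1) - F'_min`, and
every `f` for which it is discreet satisfies `p + F_min ≤ f ≤ p(k-1) - F'_min`. -/
theorem sorting_minmax_discreet (r : ℕ) (hr : 2 ≤ r) (p : Fin r → ℕ) (hp : ∀ i, 0 < p i)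
    (k : ℕ) (hk : 0 < k) :
    (k < r + 1 → ∀ f : ℕ, ¬ Discreet (by omega) p f k) ∧
    (r + 1 ≤ k →
      Discreet (by omega) p ((∑ i, p i) + Fmin p) k ∧
      Discreet (by omega) p ((∑ i, p i) * (k - 1) - Fmin (fun i => p i.rev)) k ∧
      (∀ f : ℕ, Discreet (by omega) p f k →
        (∑ i, p i) + Fmin p ≤ f ∧
        f ≤ (∑ i, p i) * (k - 1) - Fmin (fun i => p i.rev))) := by
  have hr0 : 0 < r := by omega
  have hF := Fmin_add_Fmin_rev p
  refine ⟨fun hkr f hf => ?_, fun hkr => ⟨?_, ?_, fun f hf => ⟨hf.le, ?_⟩⟩⟩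
  · have hlow := hf.le
    have hupp := hf.add_Fmin_rev_le
    have hmul : (∑ i, p i) * (k - 1) ≤ (∑ i, p i) * (r - 1) :=
      Nat.mul_le_mul_left _ (by omega)
    have hpos : 0 < ∑ i, p i := sum_pos (fun i _ => hp i) ⟨⟨0, hr0⟩, mem_univ _⟩
    omega
  · simpa using discreet_add_index hr0 p le_rfl (by omega : 1 + r ≤ k)
  · have hd := discreet_add_index hr0 p (by omega : 1 ≤ k - r) (by omega : k - r + r ≤ k)
    have hsplit : (∑ i, p i) * (k - 1) = (∑ i, p i) * (k - r) + (∑ i, p i) * (r - 1) := by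
      rw [← mul_add]
      congr 1
      omega
    convert hd using 1
    omega
  · exact Nat.le_sub_of_add_le hf.add_Fmin_rev_le
end

section
/- If there exists a general solution for f, then there exists a general solution (f_1, …, f_r) for f with f_r − f_1 ≤ (2p − p_1 − p_r)/c. -/
open Finset

theorem StrictMono.add_sub_le_fin {r : ℕ} {g : Fin r → ℕ} (hg : StrictMono g) {i j : Fin r}
    (hij : i ≤ j) : g i + (j - i : ℕ) ≤ g j := by
  obtain ⟨j, hj⟩ := j
  induction j with
  | zero =>
    have : i = ⟨0, hj⟩ := le_antisymm hij (Nat.zero_le _)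
    simp [this]
  | succ n ih =>
    rcases hij.eq_or_lt with rfl | hlt
    · simp
    · have hle : i.val ≤ n := Nat.lt_succ_iff.mp hlt
      have h₁ := ih (by omega) hle
      have h₂ : g ⟨n, by omega⟩ < g ⟨n + 1, hj⟩ := hg (Nat.lt_succ_self n)
      simp only at h₁ ⊢
      omega

/-- Among `n + 1` multiples of `c`, two are congruent modulo `n * c`. -/
theorem exists_lt_modEq_of_dvd {c n : ℕ} (hn : 0 < n) (S : ℕ → ℕ) (hS : ∀ t, c ∣ S t) :
    ∃ s t, s < t ∧ t ≤ n ∧ S s ≡ S t [MOD n * c] := by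
  choose T hT using hS
  obtain ⟨s, hs, t, ht, hst, h⟩ := Finset.exists_ne_map_eq_of_card_lt_of_maps_to
    (s := Finset.range (n + 1)) (t := Finset.range n) (f := fun k => T k % n) (by simp)
    (fun k _ => by simpa using Nat.mod_lt _ hn)
  have key : S s ≡ S t [MOD n * c] := by
    rw [hT, hT, mul_comm n c]
    exact Nat.ModEq.mul_left' c h
  simp only [Finset.mem_range] at hs ht
  rcases lt_or_gt_of_ne hst with hlt | hlt
  · exact ⟨s, t, hlt, by omega, key⟩
  · exact ⟨t, s, hlt, by omega, key.symm⟩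

/-- A general solution with large spread can be replaced by one with smaller spread. -/
theorem IsGenSol.exists_sub_lt {r : ℕ} {p : Fin r → ℕ} {f : ℕ} {g : Fin r → ℕ} (a b : Fin r)
    (ha : a.val = 0) (hp : 0 < ∑ i, p i) (hg : IsGenSol p f g)
    (hlarge : (∑ i, p i) / Finset.univ.gcd p + b ≤ g b - g a) :
    ∃ g', IsGenSol p f g' ∧ g' b - g' a < g b - g a := by
  obtain ⟨hmono, hsum⟩ := hg
  have hdvd : Finset.univ.gcd p ∣ ∑ i, p i := Finset.dvd_sum fun i hi => Finset.gcd_dvd hi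
  set c := Finset.univ.gcd p
  set n := (∑ i, p i) / c with hn
  have hnc : n * c = ∑ i, p i := Nat.div_mul_cancel hdvd
  have hn0 : 0 < n := Nat.pos_of_ne_zero fun h => by simp [h] at hnc; omega
  let G : Fin r → ℕ := fun i => g i - g a - i
  obtain ⟨s, t, hst, htn, hmod⟩ := exists_lt_modEq_of_dvd hn0
    (fun t => ∑ i, p i * min (G i) t)
    (fun t => Finset.dvd_sum fun i hi => (Finset.gcd_dvd hi).mul_right _)
  have hle : ∑ i, p i * min (G i) s ≤ ∑ i, p i * min (G i) t := by
    gcongr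
  let D : Fin r → ℕ := fun i => min (G i) t - min (G i) s
  have hD : ∑ i, p i * D i + ∑ i, p i * min (G i) s = ∑ i, p i * min (G i) t := by
    rw [← Finset.sum_add_distrib]
    refine Finset.sum_congr rfl fun i _ => ?_
    rw [← mul_add]
    congr 1
    simp only [D]
    omega
  obtain ⟨q, hq⟩ := (Nat.modEq_iff_dvd' hle).mp hmod
  have hDq : ∑ i, p i * D i = (∑ i, p i) * q := by
    rw [← hnc, ← hq]
    omega
  have hbase : ∀ i, g a + i ≤ g i := fun i => by
    have := hmono.add_sub_le_fin (i := a) (j := i) (Fin.le_def.mpr (by omega))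
    omega
  refine ⟨fun i => g i - D i + q, ⟨fun i j hij => ?_, ?_⟩, ?_⟩
  · have h₁ := hmono.add_sub_le_fin hij.le
    have h₂ := hbase i
    have h₃ := hbase j
    have h₄ : i.val < j.val := hij
    simp only [D, G]
    omega
  · have hsplit : ∑ i, p i * (g i - D i + q) + ∑ i, p i * D i
        = ∑ i, p i * g i + (∑ i, p i) * q := by
      rw [Finset.sum_mul, ← Finset.sum_add_distrib, ← Finset.sum_add_distrib]
      refine Finset.sum_congr rfl fun i _ => ?_
      have : D i ≤ g i := by simp only [D, G]; omega
      rw [← mul_add, ← mul_add]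
      congr 1
      omega
    change ∑ i, p i * (g i - D i + q) = f
    omega
  · have h₁ := hbase b
    simp only [D, G]
    omega

theorem card_sub_two_mul_gcd_le {r : ℕ} {p : Fin r → ℕ} (hp : ∀ i, 0 < p i) {a b : Fin r}
    (hab : a ≠ b) : (r - 2) * Finset.univ.gcd p + p a + p b ≤ ∑ i, p i := by
  have hb : b ∈ Finset.univ.erase a := by simp [hab.symm]
  rw [← Finset.sum_erase_add _ _ (Finset.mem_univ a), ← Finset.sum_erase_add _ _ hb]
  have hcard : ((Finset.univ.erase a).erase b).card = r - 2 := by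
    rw [Finset.card_erase_of_mem hb, Finset.card_erase_of_mem (Finset.mem_univ a)]
    simp
    omega
  have := Finset.card_nsmul_le_sum ((Finset.univ.erase a).erase b) p (Finset.univ.gcd p)
    fun i _ => Nat.le_of_dvd (hp i) (Finset.gcd_dvd (Finset.mem_univ i))
  rw [hcard, smul_eq_mul] at this
  linarith

/-- If a general solution for `f` exists, then there is a general
solution `(f_1, …, f_r)` for `f` with `f_r - f_1 ≤ (2p - p_1 - p_r)/c`. -/
theorem min_difference_in_pile (r : ℕ) (hr : 2 ≤ r) (p : Fin r → ℕ) (hp : ∀ i, 0 < p i)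
    (f : ℕ) (h : ∃ g, IsGenSol p f g) :
    ∃ g, IsGenSol p f g ∧
      g ⟨r - 1, by omega⟩ - g ⟨0, by omega⟩ ≤
        (2 * (∑ i, p i) - p ⟨0, by omega⟩ - p ⟨r - 1, by omega⟩) / Finset.univ.gcd p := by
  let a : Fin r := ⟨0, by omega⟩
  let b : Fin r := ⟨r - 1, by omega⟩
  have hab : a ≠ b := by simp [a, b, Fin.ext_iff]; omega
  have hpos : 0 < ∑ i, p i := Finset.sum_pos (fun i _ => hp i) ⟨a, Finset.mem_univ a⟩
  obtain ⟨g, hg, hmin⟩ := exists_minimalFor_of_wellFoundedLT (IsGenSol p f)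
    (fun g => g b - g a) h
  refine ⟨g, hg, ?_⟩
  have hsmall : g b - g a < (∑ i, p i) / Finset.univ.gcd p + b := by
    by_contra! hlarge
    obtain ⟨g', hg', hlt⟩ := hg.exists_sub_lt a b rfl hpos hlarge
    exact absurd (hmin hg' hlt.le) (not_le.mpr hlt)
  have hc : 0 < Finset.univ.gcd p :=
    Nat.pos_of_dvd_of_pos (Finset.gcd_dvd (Finset.mem_univ a)) (hp a)
  have hdvd : Finset.univ.gcd p ∣ ∑ i, p i := Finset.dvd_sum fun i hi => Finset.gcd_dvd hi
  have hrest := card_sub_two_mul_gcd_le hp hab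
  calc g b - g a ≤ (∑ i, p i) / Finset.univ.gcd p + (r - 2) := by
        have : b.val = r - 1 := rfl
        omega
    _ ≤ (2 * (∑ i, p i) - p a - p b) / Finset.univ.gcd p := by
        rw [Nat.le_div_iff_mul_le hc, add_mul, Nat.div_mul_cancel hdvd]
        omega
end

section
/- If there exists a general solution for f, then there exists a general solution (f_1, …, f_r) for f such that p·f_r ≤ p·(2p − p_1 − p_r)/c + f − F_min (equivalently, f_r ≤ (2p − p_1 − p_r)/c + f/p − F_min/p). -/
open Finset

/-- Collapsing the values between `s` and `t` to `s` is a monotone operation. -/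
lemma monotone_add_min_sub_min {s t : ℕ} (hst : s ≤ t) :
    Monotone fun x : ℕ => x + min x s - min x t := by
  intro x y hxy
  dsimp only
  omega

/-- A strictly increasing sequence of naturals is the staircase `i ↦ g 0 + i` plus a monotone
sequence starting at `0`. -/
lemma StrictMono.exists_monotone_excess {n : ℕ} {g : Fin (n + 1) → ℕ} (hg : StrictMono g) :
    ∃ a : Fin (n + 1) → ℕ, Monotone a ∧ a 0 = 0 ∧ ∀ i, g i = g 0 + i + a i := by
  have hmono : Monotone fun i : Fin (n + 1) => (g i : ℤ) - i := by
    refine Fin.monotone_iff_le_succ.2 fun i => ?_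
    have := hg (Fin.castSucc_lt_succ (i := i))
    simp only [Fin.val_castSucc, Fin.val_succ]
    omega
  have hle (i : Fin (n + 1)) : g 0 + i ≤ g i := by
    have := hmono (Fin.zero_le i)
    simp only [Fin.val_zero] at this
    omega
  refine ⟨fun i => g i - (g 0 + i), fun i j hij => ?_, by simp, fun i => ?_⟩
  · have := hmono hij
    have := hle i
    have := hle j
    dsimp only at *
    omega
  · exact (Nat.add_sub_cancel' (hle i)).symm

/-- If the last entry of a strictly increasing sequence exceeds its least possible value by at
least the total weight, then the last entry can be lowered without changing the weighted sum. -/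
lemma exists_strictMono_last_lt {n : ℕ} {q : Fin (n + 1) → ℕ} (hq : 0 < q 0)
    {g : Fin (n + 1) → ℕ} (hg : StrictMono g)
    (hlast : g 0 + n + ∑ i, q i ≤ g (Fin.last n)) :
    ∃ g' : Fin (n + 1) → ℕ, StrictMono g' ∧ ∑ i, q i * g' i = ∑ i, q i * g i ∧
      g' (Fin.last n) < g (Fin.last n) := by
  obtain ⟨a, ha, ha0, hga⟩ := hg.exists_monotone_excess
  have hQ : 0 < ∑ i, q i :=
    hq.trans_le (Finset.single_le_sum (fun i _ => Nat.zero_le (q i)) (Finset.mem_univ 0))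
  set Q := ∑ i, q i with hQdef
  let S : ℕ → ℕ := fun t => ∑ i, q i * min (a i) t
  obtain ⟨s, t, hst, htQ, hmod⟩ : ∃ s t, s < t ∧ t ≤ Q ∧ S s ≡ S t [MOD Q] := by
    obtain ⟨x, hx, y, hy, hxy, hS⟩ := Finset.exists_ne_map_eq_of_card_lt_of_maps_to
      (s := Finset.range (Q + 1)) (t := Finset.range Q) (f := fun t => S t % Q)
      (by simp) (fun t _ => by simpa using Nat.mod_lt _ hQ)
    simp only [Finset.mem_range] at hx hy
    rcases hxy.lt_or_gt with h | h
    · exact ⟨x, y, h, by omega, hS⟩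
    · exact ⟨y, x, h, by omega, hS.symm⟩
  have hSst : S s ≤ S t :=
    Finset.sum_le_sum fun i _ => Nat.mul_le_mul_left _ (min_le_min_left _ hst.le)
  obtain ⟨m, hm⟩ := (Nat.modEq_iff_dvd' hSst).1 hmod
  have hSt : S t = S s + Q * m := by omega
  have hm_lt : m < t - s := by
    have hlt : S t < S s + Q * (t - s) := by
      simp only [S, hQdef, Finset.sum_mul, ← Finset.sum_add_distrib]
      refine Finset.sum_lt_sum (fun i _ => ?_) ⟨0, Finset.mem_univ _, ?_⟩
      · rw [← Nat.mul_add]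
        exact Nat.mul_le_mul_left _ (by omega)
      · rw [ha0]
        simpa using ⟨hq, hst⟩
    exact Nat.lt_of_mul_lt_mul_left (a := Q) (by omega)
  refine ⟨fun i => g 0 + i + m + (a i + min (a i) s - min (a i) t), fun i j hij => ?_, ?_, ?_⟩
  · have := monotone_add_min_sub_min hst.le (ha hij.le)
    have : (i : ℕ) < j := hij
    dsimp only at *
    omega
  · have key : ∑ i, q i * (g 0 + i + m + (a i + min (a i) s - min (a i) t)) + S t =
        ∑ i, q i * g i + (S s + Q * m) := by
      simp only [S, hQdef, Finset.sum_mul, ← Finset.sum_add_distrib, ← Nat.mul_add]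
      refine Finset.sum_congr rfl fun i _ => ?_
      rw [hga i]
      congr 1
      omega
    dsimp only
    omega
  · have := hga (Fin.last n)
    simp only [Fin.val_last] at *
    omega

/-- A strictly increasing sequence whose last entry exceeds its least possible value by at most
the total weight satisfies the height bound. -/
lemma sum_mul_last_add_le {n : ℕ} {q : Fin (n + 1) → ℕ} (hq : ∀ i, 0 < q i)
    {g : Fin (n + 1) → ℕ} (hg : StrictMono g)
    (hlast : g (Fin.last n) ≤ g 0 + n + ∑ i, q i) :
    (∑ i, q i) * g (Fin.last n) + ∑ i : Fin (n + 1), (i : ℕ) * q i ≤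
      (∑ i, q i) * (2 * (∑ i, q i) - q 0 - q (Fin.last n)) + ∑ i, q i * g i := by
  obtain ⟨a, -, -, hga⟩ := hg.exists_monotone_excess
  have hsum : ∑ i, q i * g i =
      (∑ i, q i) * g 0 + ∑ i : Fin (n + 1), (i : ℕ) * q i + ∑ i, q i * a i := by
    simp only [Finset.sum_mul, ← Finset.sum_add_distrib]
    refine Finset.sum_congr rfl fun i _ => ?_
    rw [hga i]
    ring
  have hlast_sum : q (Fin.last n) * a (Fin.last n) ≤ ∑ i, q i * a i :=
    Finset.single_le_sum (f := fun i => q i * a i) (fun i _ => Nat.zero_le _)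
      (Finset.mem_univ _)
  have hn : n + q 0 ≤ ∑ i, q i := by
    rw [Fin.sum_univ_succ, add_comm]
    gcongr
    simpa using Finset.card_nsmul_le_sum Finset.univ (fun i : Fin n => q i.succ) 1
      fun i _ => hq _
  have hqlast : q (Fin.last n) ≤ ∑ i, q i :=
    Finset.single_le_sum (fun i _ => Nat.zero_le (q i)) (Finset.mem_univ _)
  have hga' := hga (Fin.last n)
  simp only [Fin.val_last] at hga'
  rw [hsum, hga']
  set Q := ∑ i, q i
  have haQ : a (Fin.last n) ≤ Q := by omega
  obtain ⟨d, hd⟩ := Nat.exists_eq_add_of_le hqlast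
  obtain ⟨e, he⟩ := Nat.exists_eq_add_of_le hn
  have hsub : 2 * Q - q 0 - q (Fin.last n) = n + e + d := by omega
  rw [hsub]
  have h1 : Q * a (Fin.last n) ≤ q (Fin.last n) * a (Fin.last n) + Q * d := by
    calc Q * a (Fin.last n) = q (Fin.last n) * a (Fin.last n) + a (Fin.last n) * d := by
          conv_lhs => rw [hd]
          ring
      _ ≤ _ := by gcongr
  nlinarith [Nat.zero_le (Q * e)]

/-- If a general solution for `f` exists, then there is a general
solution `(f_1, …, f_r)` for `f` with `p·f_r ≤ p·(2p - p_1 - p_r)/c + f - F_min`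
(stated additively to avoid truncated subtraction). -/
theorem max_coins_in_pile (r : ℕ) (hr : 2 ≤ r) (p : Fin r → ℕ) (hp : ∀ i, 0 < p i)
    (f : ℕ) (h : ∃ g, IsGenSol p f g) :
    ∃ g, IsGenSol p f g ∧
      (∑ i, p i) * g ⟨r - 1, by omega⟩ + Fmin p ≤
        (∑ i, p i) *
          ((2 * (∑ i, p i) - p ⟨0, by omega⟩ - p ⟨r - 1, by omega⟩) / Finset.univ.gcd p)
          + f := by
  obtain ⟨n, rfl⟩ : ∃ n, r = n + 1 := ⟨r - 1, by omega⟩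
  change ∃ g, IsGenSol p f g ∧ (∑ i, p i) * g (Fin.last n) + Fmin p ≤
    (∑ i, p i) * ((2 * (∑ i, p i) - p 0 - p (Fin.last n)) / Finset.univ.gcd p) + f
  obtain ⟨q, hpq, -⟩ := Finset.extract_gcd p (Finset.univ_nonempty (α := Fin (n + 1)))
  set c := Finset.univ.gcd p
  replace hpq (i : Fin (n + 1)) : p i = c * q i := hpq i (Finset.mem_univ i)
  have hc : 0 < c := Nat.pos_of_mul_pos_right (hpq 0 ▸ hp 0)
  have hq (i : Fin (n + 1)) : 0 < q i := Nat.pos_of_mul_pos_left (hpq i ▸ hp i)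
  have hsum (g : Fin (n + 1) → ℕ) : ∑ i, p i * g i = c * ∑ i, q i * g i := by
    simp only [hpq, Finset.mul_sum, mul_assoc]
  obtain ⟨g, hg, hmin⟩ := exists_minimalFor_of_wellFoundedLT (IsGenSol p f)
    (fun g => g (Fin.last n)) h
  have hlast : g (Fin.last n) ≤ g 0 + n + ∑ i, q i := by
    by_contra! hlt
    obtain ⟨g', hg', hs, hl⟩ := exists_strictMono_last_lt (hq 0) hg.1 hlt.le
    exact hl.not_ge (hmin ⟨hg', by rw [hsum, hs, ← hsum, hg.2]⟩ hl.le)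
  refine ⟨g, hg, ?_⟩
  have hP : ∑ i, p i = c * ∑ i, q i := by simp only [hpq, Finset.mul_sum]
  have hF : Fmin p = c * ∑ i : Fin (n + 1), (i : ℕ) * q i := by
    simp only [Fmin, hpq, Finset.mul_sum, mul_left_comm]
  have hdiv : (2 * (∑ i, p i) - p 0 - p (Fin.last n)) / c =
      2 * (∑ i, q i) - q 0 - q (Fin.last n) := by
    rw [hP, hpq 0, hpq (Fin.last n), mul_left_comm, ← Nat.mul_sub, ← Nat.mul_sub,
      Nat.mul_div_cancel_left _ hc]
  rw [hdiv, hP, hF, ← hg.2, hsum, mul_assoc, mul_assoc, ← Nat.mul_add, ← Nat.mul_add]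
  exact Nat.mul_le_mul_left c (sum_mul_last_add_le hq hg.1 hlast)
end

section
/- Let k be a positive integer and let f be a nonnegative integer with f ≤ pk − p·(2p − p_1 − p_r)/c + F_min. If there exists a general solution for f, then there exists a general solution for f satisfying the height bound for k. -/
open Finset

/-- Cutting the layers between heights `S` and `T` out of a monotone profile and returning their
weight as full layers lowers the top, provided that weight is divisible by the total weight. -/
lemma exists_monotone_lt_of_layers_modEq {r : ℕ} (q : Fin r → ℕ) (hq : ∀ i, 0 < q i)
    {a : Fin r → ℕ} (ha : Monotone a) (lo hi : Fin r) {S T : ℕ} (hST : S < T)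
    (hS : a lo ≤ S) (hT : T ≤ a hi)
    (hmod : (∑ i, q i * min (a i) S) ≡ (∑ i, q i * min (a i) T) [MOD ∑ i, q i]) :
    ∃ a' : Fin r → ℕ, Monotone a' ∧ ∑ i, q i * a' i = ∑ i, q i * a i ∧ a' hi < a hi := by
  have hle : ∑ i, q i * min (a i) S ≤ ∑ i, q i * min (a i) T :=
    sum_le_sum fun i _ => Nat.mul_le_mul_left _ (by omega)
  obtain ⟨m, hm⟩ := (Nat.modEq_iff_dvd' hle).1 hmod
  have hlt : ∑ i, q i * min (a i) T < ∑ i, (q i * min (a i) S + q i * (T - S)) := by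
    refine sum_lt_sum (fun i _ => ?_) ⟨lo, mem_univ _, ?_⟩
    · rw [← Nat.mul_add]
      exact Nat.mul_le_mul_left _ (by omega)
    · rw [← Nat.mul_add]
      exact Nat.mul_lt_mul_of_pos_left (by omega) (hq lo)
  rw [sum_add_distrib, ← sum_mul] at hlt
  have hmlt : m < T - S := by
    refine Nat.lt_of_mul_lt_mul_left (a := ∑ i, q i) ?_
    omega
  refine ⟨fun i => (a i - T) + min (a i) S + m, fun i j hij => ?_, ?_, ?_⟩
  · have := ha hij
    dsimp only
    omega
  · have h1 : ∑ i, q i * (a i - T + min (a i) S + m) =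
        ∑ i, q i * (a i - T) + ∑ i, q i * min (a i) S + (∑ i, q i) * m := by
      rw [sum_mul, ← sum_add_distrib, ← sum_add_distrib]
      exact sum_congr rfl fun i _ => by ring
    have h2 : ∑ i, q i * a i = ∑ i, q i * (a i - T) + ∑ i, q i * min (a i) T := by
      rw [← sum_add_distrib]
      refine sum_congr rfl fun i _ => ?_
      rw [← Nat.mul_add]
      congr 1
      omega
    rw [h1, h2]
    omega
  · dsimp only
    omega

/-- A monotone profile whose spread is at least the total weight can be lowered. -/
lemma exists_monotone_lt_of_spread {r : ℕ} (q : Fin r → ℕ) (hq : ∀ i, 0 < q i)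
    {a : Fin r → ℕ} (ha : Monotone a) (lo hi : Fin r) (h : a lo + ∑ i, q i ≤ a hi) :
    ∃ a' : Fin r → ℕ, Monotone a' ∧ ∑ i, q i * a' i = ∑ i, q i * a i ∧ a' hi < a hi := by
  have hpos : 0 < ∑ i, q i := sum_pos (fun i _ => hq i) ⟨lo, mem_univ _⟩
  obtain ⟨S, hS, T, hT, hne, heq⟩ :=
    exists_ne_map_eq_of_card_lt_of_maps_to
      (s := Icc (a lo) (a hi)) (t := range (∑ i, q i))
      (f := fun T => (∑ i, q i * min (a i) T) % ∑ i, q i)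
      (by rw [card_range, Nat.card_Icc]; omega)
      (fun T _ => by simpa using Nat.mod_lt _ hpos)
  rw [mem_Icc] at hS hT
  rcases lt_or_gt_of_ne hne with hlt | hlt
  · exact exists_monotone_lt_of_layers_modEq q hq ha lo hi hlt hS.1 hT.2 heq
  · exact exists_monotone_lt_of_layers_modEq q hq ha lo hi hlt hT.1 hS.2 heq.symm

/-- Every monotone profile can be replaced by one of the same weight whose spread is less than
the total weight. -/
lemma exists_monotone_spread_lt {r : ℕ} (q : Fin r → ℕ) (hq : ∀ i, 0 < q i)
    (a : Fin r → ℕ) (ha : Monotone a) (lo hi : Fin r) :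
    ∃ a' : Fin r → ℕ, Monotone a' ∧ ∑ i, q i * a' i = ∑ i, q i * a i ∧
      a' hi < a' lo + ∑ i, q i := by
  induction hn : a hi using Nat.strong_induction_on generalizing a with
  | _ n ih =>
    by_cases h : a hi < a lo + ∑ i, q i
    · exact ⟨a, ha, rfl, h⟩
    · obtain ⟨b, hb, hsum, hlt⟩ := exists_monotone_lt_of_spread q hq ha lo hi (not_lt.1 h)
      obtain ⟨a', ha', hsum', hspread⟩ := ih (b hi) (hn ▸ hlt) b hb rfl
      exact ⟨a', ha', hsum'.trans hsum, hspread⟩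

lemma le_apply_of_strictMono {r : ℕ} {g : Fin r → ℕ} (hg : StrictMono g) (i : Fin r) :
    (i : ℕ) ≤ g i := by
  obtain ⟨n, hn⟩ := i
  induction n with
  | zero => exact Nat.zero_le _
  | succ n ih =>
    have h1 := ih (by omega)
    have h2 : g ⟨n, by omega⟩ < g ⟨n + 1, hn⟩ := hg (by simp)
    simp only at h1 ⊢
    omega

lemma monotone_sub_of_strictMono {r : ℕ} {g : Fin r → ℕ} (hg : StrictMono g) :
    Monotone fun i => g i - (i : ℕ) := by
  have key : ∀ d : ℕ, ∀ i j : Fin r, (j : ℕ) = i + d → g i + d ≤ g j := by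
    intro d
    induction d with
    | zero =>
      intro i j h
      rw [Fin.ext h]
      rfl
    | succ d ih =>
      intro i j h
      have h1 := ih i ⟨i + d, by omega⟩ rfl
      have h2 : g ⟨i + d, by omega⟩ < g j := hg (by rw [Fin.lt_def]; simp only; omega)
      omega
  intro i j hij
  have := key (j - i) i j (by have := Fin.le_def.1 hij; omega)
  have := Fin.le_def.1 hij
  dsimp only
  omega

/-- Positive weights bound the number of indices other than a given one. -/
lemma pred_le_sum_sub {r : ℕ} (q : Fin r → ℕ) (hq : ∀ i, 0 < q i) (i : Fin r) :
    q i + (r - 1) ≤ ∑ j, q j := by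
  rw [← add_sum_erase univ q (mem_univ i)]
  have : #(univ.erase i) • 1 ≤ ∑ j ∈ univ.erase i, q j :=
    card_nsmul_le_sum _ _ _ fun j _ => hq j
  rw [card_erase_of_mem (mem_univ i), card_univ, Fintype.card_fin] at this
  simpa using this

/-- A monotone profile weighs at least as much as its top entry together with all remaining
weight at the height of its lowest entry. -/
lemma sum_mul_top_le {r : ℕ} (q a : Fin r → ℕ) (lo hi : Fin r) (hlo : ∀ i, a lo ≤ a i) :
    (∑ i, q i) * a lo + q hi * (a hi - a lo) ≤ ∑ i, q i * a i := by
  have h : ∑ i, q i * a i = (∑ i, q i) * a lo + ∑ i, q i * (a i - a lo) := by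
    rw [sum_mul, ← sum_add_distrib]
    refine sum_congr rfl fun i _ => ?_
    rw [← Nat.mul_add, Nat.add_sub_cancel' (hlo i)]
  rw [h]
  exact Nat.add_le_add_left
    (single_le_sum (f := fun i => q i * (a i - a lo)) (fun _ _ => Nat.zero_le _) (mem_univ hi)) _

/-- If `f ≤ pk - p·(2p - p_1 - p_r)/c + F_min` (stated additively)
and a general solution for `f` exists, then a general solution for `f` satisfying the
height bound for `k` exists. -/
theorem general_to_height_bound_small_f (r : ℕ) (hr : 2 ≤ r) (p : Fin r → ℕ)
    (hp : ∀ i, 0 < p i) (k : ℕ) (hk : 0 < k) (f : ℕ)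
    (hf : f + (∑ i, p i) *
        ((2 * (∑ i, p i) - p ⟨0, by omega⟩ - p ⟨r - 1, by omega⟩) / Finset.univ.gcd p) ≤
      (∑ i, p i) * k + Fmin p)
    (h : ∃ g, IsGenSol p f g) :
    ∃ g, IsGenSol p f g ∧ HeightBound (by omega) g k := by
  obtain ⟨g, hg, hgf⟩ := h
  set lo : Fin r := ⟨0, by omega⟩ with hlo
  set hi : Fin r := ⟨r - 1, by omega⟩ with hhi
  set c := univ.gcd p with hc
  have hdvd : ∀ i, c ∣ p i := fun i => gcd_dvd (mem_univ i)
  have hcpos : 0 < c := Nat.pos_of_dvd_of_pos (hdvd lo) (hp lo)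
  choose q hpq using hdvd
  have hq : ∀ i, 0 < q i := fun i => Nat.pos_of_mul_pos_left (hpq i ▸ hp i)
  obtain ⟨a, ha, hsum, hspread⟩ :=
    exists_monotone_spread_lt q hq _ (monotone_sub_of_strictMono hg) lo hi
  have hpsum : ∑ i, p i = c * ∑ i, q i := by
    rw [mul_sum]
    exact sum_congr rfl fun i _ => hpq i
  have hweight : c * ∑ i, q i * a i + Fmin p = f := by
    rw [hsum, ← hgf, Fmin, mul_sum, ← sum_add_distrib]
    refine sum_congr rfl fun i _ => ?_
    rw [← mul_assoc, ← hpq, mul_comm (i : ℕ), ← Nat.mul_add,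
      Nat.sub_add_cancel (le_apply_of_strictMono hg i)]
  refine ⟨fun i => a i + i, ⟨fun i j hij => ?_, ?_⟩, ?_⟩
  · exact add_lt_add_of_le_of_lt (ha hij.le) hij
  · rw [← hweight, Fmin, mul_sum, ← sum_add_distrib]
    refine sum_congr rfl fun i _ => ?_
    rw [← mul_assoc, ← hpq]
    ring
  · change a hi + (r - 1) ≤ k
    have hdiv : (2 * (∑ i, p i) - p lo - p hi) / c = 2 * (∑ i, q i) - q lo - q hi := by
      rw [hpsum, hpq lo, hpq hi, mul_left_comm, ← Nat.mul_sub, ← Nat.mul_sub,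
        Nat.mul_div_cancel_left _ hcpos]
    rw [hdiv, hpsum, ← hweight] at hf
    have hlo_le := pred_le_sum_sub q hq lo
    have hhi_le := pred_le_sum_sub q hq hi
    have hmin := sum_mul_top_le q a lo hi fun i => ha (Fin.le_def.2 (Nat.zero_le _))
    have hmono : a lo ≤ a hi := ha (Fin.le_def.2 (Nat.zero_le _))
    generalize ∑ i, q i * a i = N at *
    generalize ∑ i, q i = Q at *
    have hf' : N + Q * (2 * Q - q lo - q hi) ≤ Q * k := by
      refine Nat.le_of_mul_le_mul_left ?_ hcpos
      rw [Nat.mul_add, ← mul_assoc, ← mul_assoc]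
      omega
    obtain ⟨d, hd⟩ := Nat.exists_eq_add_of_le hmono
    obtain ⟨x, hx⟩ := Nat.exists_eq_add_of_le hlo_le
    obtain ⟨y, hy⟩ := Nat.exists_eq_add_of_le (le_of_add_le_left hhi_le)
    have hD : 2 * Q - q lo - q hi = y + (r - 1) + x := by omega
    rw [hD] at hf'
    have hdQ : d < Q := by omega
    have hdiff : a hi - a lo = d := by omega
    rw [hdiff] at hmin
    have hyd : y * d ≤ y * Q := Nat.mul_le_mul_left _ hdQ.le
    have hQ : 0 < Q := by omega
    refine le_of_mul_le_mul_left ?_ hQ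
    have hQd : Q * d = q hi * d + y * d := by rw [← Nat.add_mul, ← hy]
    rw [hd]
    nlinarith [Nat.zero_le (Q * x)]
end

section
/- Let k be a positive integer with k ≥ (4p − 2p_1 − 2p_r)/c + 1 − r, and let f be an integer with 0 ≤ f ≤ pk. If there exists a general solution for f with respect to (p_1, …, p_r) and there exists a general solution for pk − f with respect to the reversed tuple (p_r, …, p_1), then there exists a general solution for f with respect to (p_1, …, p_r) satisfying the height bound for k, and there exists a general solution for pk − f with respect to the reversed tuple satisfying the height bound for k. -/
open Finset

/-- A strictly increasing sequence of integers grows at least as fast as its index. -/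
theorem StrictMono.fin_add_le_add {r : ℕ} {g : Fin r → ℕ} (hg : StrictMono g) {i j : Fin r}
    (hij : i ≤ j) : g i + j ≤ g j + i := by
  obtain ⟨j, hj⟩ := j
  induction j with
  | zero =>
    have : i = ⟨0, hj⟩ := Fin.ext (by have := Fin.le_def.1 hij; simpa using this)
    simp [this]
  | succ n ih =>
    rcases hij.eq_or_lt with h | h
    · simp [h]
    · have h' : (i : ℕ) < n + 1 := h
      have h1 := ih (by omega) (Fin.le_def.2 (by simp only; omega))
      have h2 : g ⟨n, by omega⟩ < g ⟨n + 1, hj⟩ := hg (Fin.lt_def.2 (by simp))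
      simp only at h1 ⊢
      omega

/-- If the spread of a strictly increasing tuple is large compared with the total weight, then
the first entry can be increased without changing the weighted sum. -/
theorem exists_strictMono_first_lt {r : ℕ} (hr : 0 < r) (q : Fin r → ℕ) (hq : ∀ i, 0 < q i)
    (g : Fin r → ℕ) (hg : StrictMono g)
    (hspread : g ⟨0, hr⟩ + r + ∑ i, q i ≤ g ⟨r - 1, by omega⟩ + 1) :
    ∃ g' : Fin r → ℕ, StrictMono g' ∧ ∑ i, q i * g' i = ∑ i, q i * g i ∧
      g ⟨0, hr⟩ < g' ⟨0, hr⟩ := by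
  set b := ∑ i, q i with hb
  have hbpos : 0 < b := Finset.sum_pos (fun i _ => hq i) ⟨⟨0, hr⟩, Finset.mem_univ _⟩
  set m := g ⟨0, hr⟩ with hm
  have hmono : ∀ i j : Fin r, i ≤ j → g i + j ≤ g j + i := fun i j h => hg.fin_add_le_add h
  have hle : ∀ i : Fin r, m + i ≤ g i := fun i => by
    simpa using hmono ⟨0, hr⟩ i (Fin.le_def.2 (Nat.zero_le _))
  let T : ℕ → ℕ := fun s => ∑ i, q i * min (g i - i) (m + s)
  obtain ⟨s, s', hs', hss, hmod⟩ : ∃ s s', s' ≤ b ∧ s < s' ∧ T s % b = T s' % b := by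
    obtain ⟨x, hx, y, hy, hne, hxy⟩ := Finset.exists_ne_map_eq_of_card_lt_of_maps_to
      (s := Finset.range (b + 1)) (t := Finset.range b) (f := fun s => T s % b) (by simp)
      (fun s _ => by simpa using Nat.mod_lt _ hbpos)
    simp only [Finset.mem_range] at hx hy
    rcases lt_or_gt_of_ne hne with h | h
    · exact ⟨x, y, by omega, h, hxy⟩
    · exact ⟨y, x, by omega, h, hxy.symm⟩
  have hlt : T s < T s' := by
    refine Finset.sum_lt_sum (fun i _ => Nat.mul_le_mul_left _ (by omega))
      ⟨⟨r - 1, by omega⟩, Finset.mem_univ _, Nat.mul_lt_mul_of_pos_left ?_ (hq _)⟩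
    simp only
    omega
  obtain ⟨d, hd⟩ := (Nat.modEq_iff_dvd' hlt.le).1 hmod
  have hdpos : 0 < d := by
    rcases Nat.eq_zero_or_pos d with h | h
    · simp [h] at hd; omega
    · exact h
  have hT : T s' = T s + b * d := by omega
  refine ⟨fun i => i + (min (g i - i) (m + s) + (g i - i - (m + s'))) + d, ?_, ?_, ?_⟩
  · intro i j hij
    have h1 := hmono i j hij.le
    have h2 := hle i
    have h3 := hle j
    have h4 : (i : ℕ) < j := hij
    simp only
    omega
  · have key : ∑ i, q i * (i + (min (g i - i) (m + s) + (g i - i - (m + s'))) + d) + T s'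
        = ∑ i, q i * g i + T s + b * d := by
      simp only [T, hb, Finset.sum_mul, ← Finset.sum_add_distrib]
      refine Finset.sum_congr rfl fun i _ => ?_
      have h2 := hle i
      have : i + (min (g i - i) (m + s) + (g i - i - (m + s'))) + d + min (g i - i) (m + s')
        = g i + min (g i - i) (m + s) + d := by omega
      rw [← mul_add, ← mul_add, ← mul_add, this]
    simp only
    omega
  · simp only
    omega

/-- Every strictly increasing tuple can be replaced by one with the same weighted sum and with
spread bounded in terms of the length and the total weight. -/
theorem exists_strictMono_spread_le {r : ℕ} (hr : 0 < r) (q : Fin r → ℕ) (hq : ∀ i, 0 < q i)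
    (g : Fin r → ℕ) (hg : StrictMono g) :
    ∃ g' : Fin r → ℕ, StrictMono g' ∧ ∑ i, q i * g' i = ∑ i, q i * g i ∧
      g' ⟨r - 1, by omega⟩ + 2 ≤ g' ⟨0, hr⟩ + r + ∑ i, q i := by
  induction hn : (∑ i, q i * g i) - g ⟨0, hr⟩ using Nat.strong_induction_on generalizing g with
  | _ n ih =>
    by_cases h : g ⟨0, hr⟩ + r + ∑ i, q i ≤ g ⟨r - 1, by omega⟩ + 1
    · obtain ⟨g', hg', hsum, hlt⟩ := exists_strictMono_first_lt hr q hq g hg h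
      have hle : g' ⟨0, hr⟩ ≤ ∑ i, q i * g' i :=
        (Nat.le_mul_of_pos_left _ (hq _)).trans
          (Finset.single_le_sum (f := fun i => q i * g' i) (fun _ _ => Nat.zero_le _)
            (Finset.mem_univ _))
      obtain ⟨g'', h1, h2, h3⟩ := ih _ (by omega) g' hg' rfl
      exact ⟨g'', h1, h2.trans hsum, h3⟩
    · exact ⟨g, hg, rfl, by omega⟩

/-- Reversing a solution inside a pile of height `k` gives a solution for the reversed tuple. -/
theorem IsGenSol.exists_rev {r : ℕ} (hr : 0 < r) {p : Fin r → ℕ} {f k : ℕ} {g : Fin r → ℕ}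
    (hg : IsGenSol p f g) (hk : HeightBound hr g k) :
    ∃ g', IsGenSol (fun i => p i.rev) ((∑ i, p i) * k - f) g' ∧ HeightBound hr g' k := by
  have hle : ∀ i, g i ≤ k := fun i =>
    (hg.1.monotone (Fin.le_def.2 (by simp only; omega))).trans hk
  refine ⟨fun i => k - g i.rev, ⟨fun i j hij => ?_, ?_⟩, Nat.sub_le _ _⟩
  · have h1 := hg.1 (Fin.rev_lt_rev.2 hij)
    have h2 := hle i.rev
    simp only
    omega
  · have hrev : ∑ i : Fin r, p i.rev * (k - g i.rev) = ∑ i, p i * (k - g i) :=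
      Equiv.sum_comp Fin.revPerm fun i => p i * (k - g i)
    have : ∑ i, p i * (k - g i) + f = (∑ i, p i) * k := by
      rw [← hg.2, ← Finset.sum_add_distrib, Finset.sum_mul]
      exact Finset.sum_congr rfl fun i _ => by rw [← mul_add, Nat.sub_add_cancel (hle i)]
    simp only
    omega

/-- The two extreme weights plus the number of remaining ones are at most the total weight. -/
theorem first_add_last_add_le_sum {r : ℕ} (hr : 2 ≤ r) (q : Fin r → ℕ) (hq : ∀ i, 0 < q i) :
    q ⟨0, by omega⟩ + q ⟨r - 1, by omega⟩ + r ≤ ∑ i, q i + 2 := by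
  have h : ∑ i : Fin r, (1 + (if i = ⟨0, by omega⟩ then q ⟨0, by omega⟩ - 1 else 0) +
      (if i = ⟨r - 1, by omega⟩ then q ⟨r - 1, by omega⟩ - 1 else 0)) ≤ ∑ i, q i := by
    refine Finset.sum_le_sum fun i _ => ?_
    have := hq i
    split_ifs with h1 h2 h2
    · have h3 : (0 : ℕ) = r - 1 := by simpa using congrArg Fin.val (h1.symm.trans h2)
      omega
    · subst h1; omega
    · subst h2; omega
    · omega
  simp only [Finset.sum_add_distrib, Finset.sum_ite_eq', Finset.mem_univ, if_true,
    Finset.sum_const, Finset.card_univ, Fintype.card_fin, smul_eq_mul, mul_one] at h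
  have h0 := hq ⟨0, by omega⟩
  have hl := hq ⟨r - 1, by omega⟩
  omega

/-- For `k ≥ (4p - 2p_1 - 2p_r)/c + 1 - r` (stated additively as
`k + r ≥ (4p - 2p_1 - 2p_r)/c + 1`): if there is a general solution for `f` w.r.t.
`(p_1, …, p_r)` and a general solution for `pk - f` w.r.t. the reversed tuple, then both
admit solutions satisfying the height bound for `k`. -/
theorem general_to_height_bound (r : ℕ) (hr : 2 ≤ r) (p : Fin r → ℕ)
    (hp : ∀ i, 0 < p i) (k : ℕ) (hk0 : 0 < k)
    (hk : (4 * (∑ i, p i) - 2 * p ⟨0, by omega⟩ - 2 * p ⟨r - 1, by omega⟩) /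
        Finset.univ.gcd p + 1 ≤ k + r)
    (f : ℕ) (hf : f ≤ (∑ i, p i) * k)
    (h1 : ∃ g, IsGenSol p f g)
    (h2 : ∃ g, IsGenSol (fun i => p i.rev) ((∑ i, p i) * k - f) g) :
    (∃ g, IsGenSol p f g ∧ HeightBound (by omega) g k) ∧
    (∃ g, IsGenSol (fun i => p i.rev) ((∑ i, p i) * k - f) g ∧
      HeightBound (by omega) g k) := by
  have hr0 : 0 < r := by omega
  obtain ⟨c, hc⟩ : ∃ c, c = Finset.univ.gcd p := ⟨_, rfl⟩
  rw [← hc] at hk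
  have hdvd : ∀ i, c ∣ p i := fun i => hc ▸ Finset.gcd_dvd (Finset.mem_univ i)
  choose q hpq using hdvd
  have hcpos : 0 < c := Nat.pos_of_ne_zero fun h => by
    have := hp ⟨0, hr0⟩
    rw [hpq, h, zero_mul] at this
    exact this.false
  have hq : ∀ i, 0 < q i := fun i => Nat.pos_of_ne_zero fun h => by
    have := hp i
    rw [hpq, h, mul_zero] at this
    exact this.false
  have hsum : ∑ i, p i = c * ∑ i, q i := by
    rw [Finset.mul_sum]
    exact Finset.sum_congr rfl fun i _ => hpq i
  have hbound : 2 * ∑ i, q i + r ≤ k + 3 := by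
    have h := first_add_last_add_le_sum hr q hq
    have hdiv : (4 * (∑ i, p i) - 2 * p ⟨0, by omega⟩ - 2 * p ⟨r - 1, by omega⟩) / c =
        4 * (∑ i, q i) - 2 * q ⟨0, by omega⟩ - 2 * q ⟨r - 1, by omega⟩ := by
      rw [hsum, hpq ⟨0, _⟩, hpq ⟨r - 1, _⟩, mul_left_comm 4, mul_left_comm 2, mul_left_comm 2,
        ← Nat.mul_sub, ← Nat.mul_sub, Nat.mul_div_cancel_left _ hcpos]
    rw [hdiv] at hk
    omega
  obtain ⟨g₁, hg₁, hs₁⟩ := h1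
  obtain ⟨g₂, hg₂, hs₂⟩ := h2
  obtain ⟨u, hu, hus, huh⟩ := exists_strictMono_spread_le hr0 q hq g₁ hg₁
  obtain ⟨v, hv, hvs, hvh⟩ :=
    exists_strictMono_spread_le hr0 (fun i => q i.rev) (fun i => hq _) g₂ hg₂
  have hqrev : ∑ i : Fin r, q i.rev = ∑ i, q i := Equiv.sum_comp Fin.revPerm q
  have hprev : ∑ i : Fin r, p i.rev = ∑ i, p i := Equiv.sum_comp Fin.revPerm p
  rw [hqrev] at hvh
  have hU : IsGenSol p f u := by
    refine ⟨hu, ?_⟩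
    rw [← hs₁]
    simp only [hpq, mul_assoc, ← Finset.mul_sum, hus]
  have hV : IsGenSol (fun i => p i.rev) ((∑ i, p i) * k - f) v := by
    refine ⟨hv, ?_⟩
    rw [← hs₂]
    simp only [hpq, mul_assoc, ← Finset.mul_sum, hvs]
  by_cases hUk : HeightBound hr0 u k
  · exact ⟨⟨u, hU, hUk⟩, hU.exists_rev hr0 hUk⟩
  by_cases hVk : HeightBound hr0 v k
  · obtain ⟨w, hw, hwk⟩ := hV.exists_rev hr0 hVk
    refine ⟨⟨w, ?_, hwk⟩, ⟨v, hV, hVk⟩⟩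
    simpa only [Fin.rev_rev, hprev, Nat.sub_sub_self hf] using hw
  exfalso
  unfold HeightBound at hUk hVk
  have htotal : ∑ i, p i * (u i + v i.rev) = (∑ i, p i) * k := by
    have hV' : ∑ i, p i * v i.rev = (∑ i, p i) * k - f := by
      rw [← hV.2, ← Equiv.sum_comp Fin.revPerm]
      simp
    simp only [mul_add, Finset.sum_add_distrib]
    rw [hV', hU.2]
    omega
  have hlow : (∑ i, p i) * (u ⟨0, hr0⟩ + v ⟨0, hr0⟩ + (r - 1)) ≤ (∑ i, p i) * k := by
    rw [← htotal, Finset.sum_mul]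
    refine Finset.sum_le_sum fun i _ => Nat.mul_le_mul_left _ ?_
    have h1 := hu.fin_add_le_add (i := ⟨0, hr0⟩) (j := i) (Fin.le_def.2 (Nat.zero_le _))
    have h2 := hv.fin_add_le_add (i := ⟨0, hr0⟩) (j := i.rev) (Fin.le_def.2 (Nat.zero_le _))
    rw [Fin.val_rev] at h2
    simp only at h1 h2
    omega
  have hPpos : 0 < ∑ i, p i := Finset.sum_pos (fun i _ => hp i) ⟨⟨0, hr0⟩, Finset.mem_univ _⟩
  have := Nat.le_of_mul_le_mul_left hlow hPpos
  omega
end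

section
/- Let γ (respectively γ') denote the minimal nonnegative integer divisible by c such that every multiple of c exceeding it admits a general solution with respect to (p_1, …, p_r) (respectively with respect to the reversed tuple (p_r, …, p_1)). Then γ < p·(2p − p_1 − p_r)/c − F'_min and γ' < p·(2p − p_1 − p_r)/c − F_min; equivalently, every multiple of c that is at least p·(2p − p_1 − p_r)/c − F'_min admits a general solution with respect to (p_1, …, p_r), and every multiple of c that is at least p·(2p − p_1 − p_r)/c − F_min admits a general solution with respect to the reversed tuple. -/
open Finset

/-- Bézout's identity for the gcd of finitely many natural numbers. -/
theorem exists_int_sum_mul_eq_gcd {ι : Type*} (s : Finset ι) (p : ι → ℕ) :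
    ∃ z : ι → ℤ, ∑ i ∈ s, (p i : ℤ) * z i = (s.gcd p : ℕ) := by
  classical
  induction s using Finset.induction_on with
  | empty => exact ⟨0, by simp⟩
  | insert a s ha ih =>
    obtain ⟨z, hz⟩ := ih
    refine ⟨fun i => if i = a then (p a).gcdA (s.gcd p) else z i * (p a).gcdB (s.gcd p), ?_⟩
    rw [Finset.sum_insert ha, Finset.gcd_insert]
    have h : ∑ i ∈ s, (p i : ℤ) *
        (if i = a then (p a).gcdA (s.gcd p) else z i * (p a).gcdB (s.gcd p)) =
        (s.gcd p : ℕ) * (p a).gcdB (s.gcd p) := by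
      rw [← hz, Finset.sum_mul]
      refine Finset.sum_congr rfl fun i hi => ?_
      rw [if_neg (ne_of_mem_of_not_mem hi ha), mul_assoc]
    simp only [h, if_true]
    exact (Nat.gcd_eq_gcd_ab _ _).symm

/-- Every multiple of `gcd p` is congruent, modulo any `m > 0`, to the weight `∑ i, p i * h i` of
a monotone tuple `h`. -/
theorem exists_monotone_sum_modEq {r : ℕ} (p : Fin r → ℕ) {m n : ℕ} (hm : 0 < m)
    (hn : Finset.univ.gcd p ∣ n) :
    ∃ h : Fin r → ℕ, Monotone h ∧ ∑ i, p i * h i ≡ n [MOD m] := by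
  obtain ⟨z, hz⟩ := exists_int_sum_mul_eq_gcd Finset.univ p
  obtain ⟨k, rfl⟩ := hn
  have hm' : (0 : ℤ) < m := by exact_mod_cast hm
  have hnonneg (i : Fin r) : 0 ≤ z i * k % m := Int.emod_nonneg _ hm'.ne'
  have hlt (i : Fin r) : z i * k % m < m := Int.emod_lt_of_pos _ hm'
  refine ⟨fun i => (z i * k % m).toNat + i * m, ?_, ?_⟩
  · intro i j hij
    rcases hij.eq_or_lt with rfl | hij
    · exact le_rfl
    · have hmul : ((i : ℕ) + 1) * m ≤ j * m := Nat.mul_le_mul_right m hij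
      have := hlt i
      have := hnonneg i
      grind
  · rw [← Int.natCast_modEq_iff]
    push_cast
    rw [← hz, Finset.sum_mul]
    refine Int.ModEq.sum fun i _ => ?_
    rw [Int.toNat_of_nonneg (hnonneg i), mul_assoc]
    refine Int.ModEq.mul_left _ ?_
    simp [Int.ModEq]

/-- A monotone tuple can be lowered, preserving its weight modulo `gcd p * m`, until a given
entry is smaller than `m`. -/
theorem exists_monotone_lt_sum_modEq {r : ℕ} (p : Fin r → ℕ) (l : Fin r) {m : ℕ}
    (hm : 0 < m) (h : Fin r → ℕ) (hh : Monotone h) :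
    ∃ h' : Fin r → ℕ, Monotone h' ∧
      ∑ i, p i * h' i ≡ ∑ i, p i * h i [MOD Finset.univ.gcd p * m] ∧ h' l < m := by
  induction hk : h l using Nat.strong_induction_on generalizing h with
  | _ k ih =>
  subst hk
  rcases lt_or_ge (h l) m with hlt | hge
  · exact ⟨h, hh, rfl, hlt⟩
  let w (t : ℕ) : ℕ := ∑ i, p i * min (h i) t
  have hdvd (t : ℕ) : Finset.univ.gcd p ∣ w t :=
    Finset.dvd_sum fun i _ => (Finset.gcd_dvd (Finset.mem_univ i)).mul_right _
  obtain ⟨t, s, hts, hs, hw⟩ : ∃ t s, t < s ∧ s ≤ m ∧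
      w t ≡ w s [MOD Finset.univ.gcd p * m] := by
    obtain ⟨t, ht, s, hs, hne, heq⟩ := Finset.exists_ne_map_eq_of_card_lt_of_maps_to
      (s := Finset.range (m + 1)) (t := Finset.range m)
      (f := fun t => w t / Finset.univ.gcd p % m) (by simp)
      (fun t _ => by simpa using Nat.mod_lt _ hm)
    have hw : w t ≡ w s [MOD Finset.univ.gcd p * m] := by
      rw [← Nat.mul_div_cancel' (hdvd t), ← Nat.mul_div_cancel' (hdvd s)]
      exact Nat.ModEq.mul_left' _ heq
    rw [Finset.mem_range, Nat.lt_succ_iff] at ht hs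
    rcases hne.lt_or_gt with hlt | hlt
    · exact ⟨t, s, hlt, hs, hw⟩
    · exact ⟨s, t, hlt, ht, hw.symm⟩
  let h₁ (i : Fin r) : ℕ := h i - min (h i) s + min (h i) t
  have hh₁ : Monotone h₁ := by
    intro i j hij
    have := hh hij
    simp only [h₁]
    omega
  have hsum : ∑ i, p i * h₁ i + w s = ∑ i, p i * h i + w t := by
    simp only [w, ← Finset.sum_add_distrib, ← mul_add]
    refine Finset.sum_congr rfl fun i _ => ?_
    congr 1
    simp only [h₁]
    omega
  have hmod : ∑ i, p i * h₁ i ≡ ∑ i, p i * h i [MOD Finset.univ.gcd p * m] :=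
    Nat.ModEq.add_right_cancel hw.symm (by rw [hsum])
  obtain ⟨h', hmono, hmod', hlt⟩ := ih (h₁ l) (by simp only [h₁]; omega) h₁ hh₁ rfl
  exact ⟨h', hmono, hmod'.trans hmod, hlt⟩

/-- Every multiple `n ≥ (∑ i, p i) * (p l / gcd p)` of `gcd p`, where `l` is the last index, is
the weight of a monotone tuple. -/
theorem exists_monotone_sum_eq {r : ℕ} (p : Fin r → ℕ) (l : Fin r) (hl : ∀ i, i ≤ l)
    (hp : 0 < p l) {n : ℕ} (hn : Finset.univ.gcd p ∣ n)
    (hle : (∑ i, p i) * (p l / Finset.univ.gcd p) ≤ n) :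
    ∃ h : Fin r → ℕ, Monotone h ∧ ∑ i, p i * h i = n := by
  have hdvd : Finset.univ.gcd p ∣ p l := Finset.gcd_dvd (Finset.mem_univ l)
  have hc : 0 < Finset.univ.gcd p := Nat.pos_of_dvd_of_pos hdvd hp
  have hm : 0 < p l / Finset.univ.gcd p := Nat.div_pos (Nat.le_of_dvd hp hdvd) hc
  obtain ⟨h₀, hh₀, hmod₀⟩ := exists_monotone_sum_modEq p hp hn
  obtain ⟨h, hh, hmod, hlt⟩ := exists_monotone_lt_sum_modEq p l hm h₀ hh₀
  rw [Nat.mul_div_cancel' hdvd] at hmod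
  have hbound : ∑ i, p i * h i ≤ n := by
    refine le_trans ?_ hle
    rw [Finset.sum_mul]
    exact Finset.sum_le_sum fun i _ => Nat.mul_le_mul_left _ ((hh (hl i)).trans hlt.le)
  obtain ⟨k, hk⟩ := (Nat.modEq_iff_dvd' hbound).1 (hmod.trans hmod₀)
  refine ⟨fun i => h i + if i = l then k else 0, ?_, ?_⟩
  · intro i j hij
    have := hh hij
    have := hl j
    dsimp only
    split_ifs with hi hj
    · omega
    · exact absurd (le_antisymm this (hi ▸ hij)) hj
    · omega
    · omega
  · simp only [mul_add, Finset.sum_add_distrib, mul_ite, mul_zero, Finset.sum_ite_eq',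
      Finset.mem_univ, if_true]
    omega

/-- Every multiple of `gcd p` that is at least `Fmin p + (∑ i, p i) * (p l / gcd p)`, where `l` is
the last index, has a general solution. -/
theorem exists_isGenSol {r : ℕ} (p : Fin r → ℕ) (l : Fin r) (hl : ∀ i, i ≤ l)
    (hp : 0 < p l) {f : ℕ} (hf : Finset.univ.gcd p ∣ f)
    (hle : Fmin p + (∑ i, p i) * (p l / Finset.univ.gcd p) ≤ f) :
    ∃ g, IsGenSol p f g := by
  have hF : Finset.univ.gcd p ∣ Fmin p :=
    Finset.dvd_sum fun i _ => (Finset.gcd_dvd (Finset.mem_univ i)).mul_left _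
  obtain ⟨h, hh, hsum⟩ := exists_monotone_sum_eq p l hl hp (n := f - Fmin p)
    (Nat.dvd_sub hf hF) (by omega)
  refine ⟨fun i => i + h i, fun i j hij => add_lt_add_of_lt_of_le hij (hh hij.le), ?_⟩
  simp only [mul_add, Finset.sum_add_distrib, hsum]
  have : ∑ i : Fin r, p i * (i : ℕ) = Fmin p := Finset.sum_congr rfl fun i _ => mul_comm _ _
  omega

theorem gcd_comp_rev {r : ℕ} (p : Fin r → ℕ) :
    Finset.univ.gcd (fun i : Fin r => p i.rev) = Finset.univ.gcd p :=
  Nat.dvd_antisymm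
    (Finset.dvd_gcd fun i _ => by
      simpa using Finset.gcd_dvd (f := fun i : Fin r => p i.rev) (Finset.mem_univ i.rev))
    (Finset.dvd_gcd fun i _ => Finset.gcd_dvd (Finset.mem_univ i.rev))

theorem div_gcd_add_pred_le {r : ℕ} (hr : 2 ≤ r) (p : Fin r → ℕ) (hp : ∀ i, 0 < p i) :
    p ⟨r - 1, by omega⟩ / Finset.univ.gcd p + (r - 1) ≤
      (2 * (∑ i, p i) - p ⟨0, by omega⟩ - p ⟨r - 1, by omega⟩) / Finset.univ.gcd p := by
  set a : Fin r := ⟨0, by omega⟩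
  set l : Fin r := ⟨r - 1, by omega⟩
  have hdvd (i : Fin r) : Finset.univ.gcd p ∣ p i := Finset.gcd_dvd (Finset.mem_univ i)
  have hc : 0 < Finset.univ.gcd p := Nat.pos_of_dvd_of_pos (hdvd l) (hp l)
  have hal : a ≠ l := by simp only [a, l, ne_eq, Fin.mk.injEq]; omega
  have h_two : p a + p l ≤ ∑ i, p i := by
    rw [← Finset.sum_pair hal]
    exact Finset.sum_le_sum_of_subset (Finset.subset_univ _)
  have h_rest : (r - 1) * Finset.univ.gcd p + p l ≤ ∑ i, p i := by
    rw [← Finset.sum_erase_add _ _ (Finset.mem_univ l)]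
    gcongr
    have := Finset.card_nsmul_le_sum (Finset.univ.erase l) p (Finset.univ.gcd p)
      fun i _ => Nat.le_of_dvd (hp i) (hdvd i)
    simpa using this
  rw [Nat.le_div_iff_mul_le hc, add_mul, Nat.div_mul_cancel (hdvd l)]
  omega

/-- The bound on the least threshold beyond which every multiple of `gcd p` has a general
solution. -/
theorem threshold_add_Fmin_rev_lt {r : ℕ} (hr : 2 ≤ r) (p : Fin r → ℕ) (hp : ∀ i, 0 < p i) {γ : ℕ}
    (hγ : Finset.univ.gcd p ∣ γ ∧
      ∀ f : ℕ, γ < f → Finset.univ.gcd p ∣ f → ∃ g, IsGenSol p f g)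
    (hmin : ∀ γ₀ : ℕ, (Finset.univ.gcd p ∣ γ₀ ∧
      ∀ f : ℕ, γ₀ < f → Finset.univ.gcd p ∣ f → ∃ g, IsGenSol p f g) → γ ≤ γ₀) :
    γ + Fmin (fun i => p i.rev) <
      (∑ i, p i) *
        ((2 * (∑ i, p i) - p ⟨0, by omega⟩ - p ⟨r - 1, by omega⟩) / Finset.univ.gcd p) := by
  refine lt_of_lt_of_le ?_ (Nat.mul_le_mul_left _ (div_gcd_add_pred_le hr p hp))
  set l : Fin r := ⟨r - 1, by omega⟩
  have hl (i : Fin r) : i ≤ l := Fin.le_def.2 (by simp only [l]; omega)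
  have hdvd : Finset.univ.gcd p ∣ p l := Finset.gcd_dvd (Finset.mem_univ l)
  have hc : 0 < Finset.univ.gcd p := Nat.pos_of_dvd_of_pos hdvd (hp l)
  rw [mul_add, ← Fmin_add_Fmin_rev]
  by_contra! hlt
  have hle : Fmin p + (∑ i, p i) * (p l / Finset.univ.gcd p) ≤ γ := by omega
  have hpos : 0 < (∑ i, p i) * (p l / Finset.univ.gcd p) :=
    Nat.mul_pos (Finset.sum_pos (fun i _ => hp i) ⟨l, Finset.mem_univ l⟩)
      (Nat.div_pos (Nat.le_of_dvd (hp l) hdvd) hc)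
  have hcγ : Finset.univ.gcd p ≤ γ := Nat.le_of_dvd (by omega) hγ.1
  have hsub : Finset.univ.gcd p ∣ γ - Finset.univ.gcd p := Nat.dvd_sub hγ.1 dvd_rfl
  have := hmin (γ - Finset.univ.gcd p) ⟨hsub, fun f hf hdf => by
    have hge := Nat.le_of_dvd (by omega) (Nat.dvd_sub hdf hsub)
    exact exists_isGenSol p l hl (hp l) hdf (by omega)⟩
  omega

/-- Let `γ` (resp. `γ'`) be the minimal nonnegative multiple of `c`
such that every larger multiple of `c` admits a general solution w.r.t. `(p_1, …, p_r)`
(resp. w.r.t. the reversed tuple). Then `γ < p·(2p - p_1 - p_r)/c - F'_min` and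
`γ' < p·(2p - p_1 - p_r)/c - F_min` (stated additively). -/
theorem gamma_bounds (r : ℕ) (hr : 2 ≤ r) (p : Fin r → ℕ) (hp : ∀ i, 0 < p i)
    (γ γ' : ℕ)
    (hγ : (Finset.univ.gcd p ∣ γ ∧
        ∀ f : ℕ, γ < f → Finset.univ.gcd p ∣ f → ∃ g, IsGenSol p f g) ∧
      ∀ γ₀ : ℕ,
        (Finset.univ.gcd p ∣ γ₀ ∧
          ∀ f : ℕ, γ₀ < f → Finset.univ.gcd p ∣ f → ∃ g, IsGenSol p f g) →
        γ ≤ γ₀)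
    (hγ' : (Finset.univ.gcd p ∣ γ' ∧
        ∀ f : ℕ, γ' < f → Finset.univ.gcd p ∣ f →
          ∃ g, IsGenSol (fun i => p i.rev) f g) ∧
      ∀ γ₀ : ℕ,
        (Finset.univ.gcd p ∣ γ₀ ∧
          ∀ f : ℕ, γ₀ < f → Finset.univ.gcd p ∣ f →
            ∃ g, IsGenSol (fun i => p i.rev) f g) →
        γ' ≤ γ₀) :
    γ + Fmin (fun i => p i.rev) <
      (∑ i, p i) *
        ((2 * (∑ i, p i) - p ⟨0, by omega⟩ - p ⟨r - 1, by omega⟩) / Finset.univ.gcd p) ∧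
    γ' + Fmin p <
      (∑ i, p i) *
        ((2 * (∑ i, p i) - p ⟨0, by omega⟩ - p ⟨r - 1, by omega⟩) / Finset.univ.gcd p) := by
  refine ⟨threshold_add_Fmin_rev_lt hr p hp hγ.1 hγ.2, ?_⟩
  have h := threshold_add_Fmin_rev_lt hr (fun i => p i.rev) (fun i => hp i.rev) (γ := γ')
    (by simpa only [gcd_comp_rev] using hγ'.1) (by simpa only [gcd_comp_rev] using hγ'.2)
  have hsum : ∑ i : Fin r, p i.rev = ∑ i, p i := Equiv.sum_comp Fin.revPerm p
  have hfirst : (⟨0, by omega⟩ : Fin r).rev = ⟨r - 1, by omega⟩ := by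
    ext; simp [Fin.val_rev]
  have hlast : (⟨r - 1, by omega⟩ : Fin r).rev = ⟨0, by omega⟩ := by
    ext; simp only [Fin.val_rev]; omega
  simpa only [gcd_comp_rev, hsum, hfirst, hlast, Fin.rev_rev,
    Nat.sub_right_comm _ (p ⟨r - 1, _⟩) (p ⟨0, _⟩)] using h
end

section
/- There exist nonnegative integers δ and δ' (depending only on p_1, …, p_r) such that for every positive integer k with k ≥ (4p − 2p_1 − 2p_r)/c + 2 − r and every integer f divisible by c with δ < f < pk − δ', the sorting strategy is discreet for f with pile size k. -/
open Finset

/-- Bézout's identity for a finite family of natural numbers. -/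
lemma exists_sum_mul_eq_natCast_gcd {ι : Type*} (s : Finset ι) (p : ι → ℕ) :
    ∃ b : ι → ℤ, ∑ i ∈ s, (p i : ℤ) * b i = (s.gcd p : ℕ) := by
  obtain ⟨b, hb⟩ := s.gcd_eq_sum_mul fun i => (p i : ℤ)
  have hdvd : (s.gcd fun i => (p i : ℤ)) ∣ ((s.gcd p : ℕ) : ℤ) := by
    rw [← Int.natAbs_dvd_natAbs, Int.natAbs_natCast]
    exact Finset.dvd_gcd fun i hi => by
      simpa using Int.natAbs_dvd_natAbs.mpr (Finset.gcd_dvd (f := fun i => (p i : ℤ)) hi)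
  obtain ⟨t, ht⟩ := hdvd
  refine ⟨fun i => b i * t, ?_⟩
  simp only [← mul_assoc, ← Finset.sum_mul, ht, ← hb]

/-- Every multiple of `gcd p` is represented by a strictly increasing integer tuple. -/
lemma exists_strictMono_sum_mul_eq {r : ℕ} (p : Fin r → ℕ) (hp : ∀ i, 0 < p i) {s : ℕ}
    (hs : Finset.univ.gcd p ∣ s) :
    ∃ h : Fin r → ℤ, StrictMono h ∧ ∑ i, (p i : ℤ) * h i = s := by
  obtain ⟨b, hb⟩ := exists_sum_mul_eq_natCast_gcd Finset.univ p
  obtain ⟨t, rfl⟩ := hs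
  set P : ℤ := ∑ i, (p i : ℤ) with hP
  set F : ℤ := ∑ i, (p i : ℤ) * ((i : ℕ) : ℤ) with hF
  set A : ℤ := ∑ i, |b i * t| with hA
  have hbound (i : Fin r) : |b i * t| ≤ A :=
    Finset.single_le_sum (f := fun i => |b i * t|) (fun _ _ => abs_nonneg _) (Finset.mem_univ i)
  refine ⟨fun i => b i * t + (2 * A + 1) * (P * ((i : ℕ) : ℤ) - F), fun i j hij => ?_, ?_⟩
  · have hP1 : 1 ≤ P := by
      have h1 : (p i : ℤ) ≤ P :=
        Finset.single_le_sum (f := fun i => (p i : ℤ)) (fun _ _ => by positivity)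
          (Finset.mem_univ i)
      have h2 := hp i
      omega
    have hA0 : 0 ≤ A := (abs_nonneg _).trans (hbound i)
    have hgap : (1 : ℤ) ≤ ((j : ℕ) : ℤ) - ((i : ℕ) : ℤ) := by
      have : (i : ℕ) < j := hij
      omega
    have hmul : 1 ≤ P * (((j : ℕ) : ℤ) - ((i : ℕ) : ℤ)) := by nlinarith
    have hi := (abs_le.mp (hbound i)).2
    have hj := (abs_le.mp (hbound j)).1
    dsimp only
    nlinarith
  · calc ∑ i, (p i : ℤ) * (b i * t + (2 * A + 1) * (P * ((i : ℕ) : ℤ) - F))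
        = (∑ i, (p i : ℤ) * b i) * t
            + (2 * A + 1) * (P * ∑ i, (p i : ℤ) * ((i : ℕ) : ℤ) - (∑ i, (p i : ℤ)) * F) := by
          simp only [Finset.sum_mul, Finset.mul_sum, ← Finset.sum_sub_distrib,
            ← Finset.sum_add_distrib]
          exact Finset.sum_congr rfl fun i _ => by ring
      _ = _ := by
          rw [hb, ← hF, ← hP]
          push_cast
          ring

/-- The tuples of `exists_strictMono_sum_mul_eq` can be bounded uniformly for bounded sums. -/
lemma exists_bound_strictMono_sum_mul_eq {r : ℕ} (p : Fin r → ℕ) (hp : ∀ i, 0 < p i) (n : ℕ) :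
    ∃ B : ℕ, ∀ s < n, Finset.univ.gcd p ∣ s →
      ∃ h : Fin r → ℤ, StrictMono h ∧ ∑ i, (p i : ℤ) * h i = s ∧ ∀ i, |h i| ≤ B := by
  choose! h hmono hsum using fun (s : ℕ) (hs : Finset.univ.gcd p ∣ s) =>
    exists_strictMono_sum_mul_eq p hp hs
  refine ⟨∑ s ∈ Finset.range n, ∑ i, (h s i).natAbs, fun s hs hd =>
    ⟨h s, hmono s hd, hsum s hd, fun i => ?_⟩⟩
  have h1 : (h s i).natAbs ≤ ∑ i, (h s i).natAbs :=
    Finset.single_le_sum (f := fun i => (h s i).natAbs) (fun _ _ => Nat.zero_le _)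
      (Finset.mem_univ i)
  have h2 : ∑ i, (h s i).natAbs ≤ ∑ s ∈ Finset.range n, ∑ i, (h s i).natAbs :=
    Finset.single_le_sum (f := fun s => ∑ i, (h s i).natAbs) (fun _ _ => Nat.zero_le _)
      (Finset.mem_range.mpr hs)
  rw [Int.abs_eq_natAbs]
  exact_mod_cast h1.trans h2

/-- There exist `δ, δ'` (depending only on `p_1, …, p_r`) such that
for every `k ≥ (4p - 2p_1 - 2p_r)/c + 2 - r` (stated additively) and every `f` divisible
by `c` with `δ < f < pk - δ'`, the sorting strategy is discreet for `f` with pile size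
`k`. -/
theorem arithmetic_progression_discreet (r : ℕ) (hr : 2 ≤ r) (p : Fin r → ℕ)
    (hp : ∀ i, 0 < p i) :
    ∃ δ δ' : ℕ, ∀ k : ℕ, 0 < k →
      (4 * (∑ i, p i) - 2 * p ⟨0, by omega⟩ - 2 * p ⟨r - 1, by omega⟩) /
          Finset.univ.gcd p + 2 ≤ k + r →
      ∀ f : ℕ, Finset.univ.gcd p ∣ f → δ < f → f + δ' < (∑ i, p i) * k →
        Discreet (by omega) p f k := by
  set P := ∑ i, p i with hP
  obtain ⟨B, hB⟩ := exists_bound_strictMono_sum_mul_eq p hp P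
  refine ⟨P * (B + 2), P * (B + 2), fun k _ _ f hf hδ hδ' => ?_⟩
  have hP0 : 0 < P := Finset.sum_pos (fun i _ => hp i) ⟨⟨0, by omega⟩, Finset.mem_univ _⟩
  have hcP : Finset.univ.gcd p ∣ P := Finset.dvd_sum fun i hi => Finset.gcd_dvd hi
  obtain ⟨h, hmono, hsum, hbound⟩ :=
    hB (f % P) (Nat.mod_lt f hP0) ((Nat.dvd_mod_iff hcP).mpr hf)
  have hdiv := Nat.div_add_mod f P
  have hq : B + 2 ≤ f / P := (Nat.le_div_iff_mul_le hP0).mpr (by linarith)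
  have hqk : f / P + (B + 2) < k := by
    refine lt_of_mul_lt_mul_left (a := P) ?_ (Nat.zero_le P)
    rw [mul_add]
    omega
  have hcast (i : Fin r) : (((f / P + h i).toNat : ℕ) : ℤ) = f / P + h i := by
    have := abs_le.mp (hbound i)
    have : ((B : ℤ) + 2) ≤ f / P := by exact_mod_cast hq
    omega
  have hsol : IsGenSol p f fun i => (f / P + h i).toNat := by
    refine ⟨fun i j hij => ?_, ?_⟩
    · have := hmono hij
      zify
      rw [hcast, hcast]
      omega
    · zify
      simp only [hcast, mul_add, Finset.sum_add_distrib, hsum, ← Finset.sum_mul]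
      have : (∑ i, (p i : ℤ)) = (P : ℤ) := by rw [hP]; push_cast; rfl
      rw [this]
      exact_mod_cast hdiv
  have hrange (i : Fin r) : 1 ≤ (f / P + h i).toNat ∧ (f / P + h i).toNat ≤ k - 1 := by
    have h1 := abs_le.mp (hbound i)
    have h2 : ((B : ℤ) + 2) ≤ f / P := by exact_mod_cast hq
    have h3 : (f : ℤ) / P + (B + 2) < k := by exact_mod_cast hqk
    omega
  have hheight : HeightBound (by omega) (fun i => (f / P + h i).toNat) k :=
    (hrange _).2.trans (Nat.sub_le k 1)
  exact ⟨⟨_, hsol, hheight, (hrange _).1⟩, ⟨_, hsol, hheight, (hrange _).2⟩⟩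
end
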